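/- Let N ≥ 1 and let w : Fin N → ℝ be normalized weights, i.e. wᵢ ≥ 0 for all i and Σᵢ wᵢ = 1. Let C : Fin (N+1) → ℝ denote the cumulative sums C_i = Σ_{j < i} w_j (so C_0 = 0 and C_N = 1). For u ∈ [0,1) and i ∈ Fin N, let n_i(u) := #{ j ∈ Fin N : C_i ≤ (j + u)/N < C_{i+1} } be the number of offspring assigned to particle i by systematic (universal) resampling with uniform offset u. Then for every i, ∫₀¹ n_i(u) du = N · wᵢ; i.e., if U is uniformly distributed on [0,1), the expected number of copies of particle i produced by systematic resampling equals N wᵢ. -/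

import Mathlib

open MeasureTheory

/-- Unfolding the unit interval: integrating the sum of the integer translates of `f` over `[0, 1]`
gives the integral of `f` over `[0, N]`. -/
theorem intervalIntegral_sum_translates (f : ℝ → ℝ) (hf : Integrable f) (N : ℕ) :
    ∫ u in (0 : ℝ)..1, ∑ j : Fin N, f ((j : ℝ) + u) = ∫ x in (0 : ℝ)..N, f x := by
  rw [intervalIntegral.integral_finsetSum
    fun (j : Fin N) _ => (hf.comp_add_left ((j : ℕ) : ℝ)).intervalIntegrable]
  simp only [intervalIntegral.integral_comp_add_left, add_zero]
  rw [Fin.sum_univ_eq_sum_range (fun k : ℕ => ∫ x in (k : ℝ)..(k : ℝ) + 1, f x) N]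
  have h := intervalIntegral.sum_integral_adjacent_intervals (f := f) (μ := volume)
    (a := fun k : ℕ => (k : ℝ)) (n := N) fun k _ => hf.intervalIntegrable
  simpa using h

/-- The number of points of the grid `j + u`, `j < N`, lying in `[a, b) ⊆ [0, N]` has mean `b - a`
when `u` is uniform on `[0, 1)`. -/
theorem setIntegral_card_translates_mem_Ico {a b : ℝ} {N : ℕ} (ha : 0 ≤ a) (hab : a ≤ b)
    (hb : b ≤ N) :
    ∫ u in Set.Ico (0 : ℝ) 1,
      ((Finset.univ.filter fun j : Fin N => a ≤ (j : ℝ) + u ∧ (j : ℝ) + u < b).card : ℝ)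
      = b - a := by
  have hint : Integrable ((Set.Ico a b).indicator (1 : ℝ → ℝ)) := by
    rw [integrable_indicator_iff measurableSet_Ico]
    exact integrableOn_const (by simp)
  have hcard (u : ℝ) :
      ((Finset.univ.filter fun j : Fin N => a ≤ (j : ℝ) + u ∧ (j : ℝ) + u < b).card : ℝ)
        = ∑ j : Fin N, (Set.Ico a b).indicator (1 : ℝ → ℝ) ((j : ℝ) + u) := by
    simp [Set.indicator_apply]
  simp only [hcard]
  rw [integral_Ico_eq_integral_Ioc, ← intervalIntegral.integral_of_le zero_le_one,
    intervalIntegral_sum_translates _ hint, intervalIntegral.integral_of_le (Nat.cast_nonneg N),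
    ← integral_Ico_eq_integral_Ioc, setIntegral_indicator measurableSet_Ico,
    Set.inter_eq_self_of_subset_right (Set.Ico_subset_Ico ha hb)]
  simp [hab]

/-- Unbiasedness of systematic (universal) resampling: with cumulative weights
`Cᵢ = ∑_{j<i} wⱼ` and offspring counts
`nᵢ(u) = #{j : Cᵢ ≤ (j+u)/N < Cᵢ₊₁}`, the expected number of copies of particle `i`
under a uniform offset `u ∈ [0,1)` equals `N wᵢ`. -/
theorem systematic_resampling_unbiased (N : ℕ) (hN : 1 ≤ N) (w : Fin N → ℝ)
    (hw : ∀ i, 0 ≤ w i) (hsum : ∑ i, w i = 1)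
    (C : Fin (N + 1) → ℝ)
    (hC : ∀ i : Fin (N + 1),
      C i = ∑ j ∈ Finset.univ.filter (fun j : Fin N => (j : ℕ) < (i : ℕ)), w j)
    (n : Fin N → ℝ → ℕ)
    (hn : ∀ (i : Fin N) (u : ℝ),
      n i u = (Finset.univ.filter (fun j : Fin N =>
        C i.castSucc ≤ ((j : ℝ) + u) / (N : ℝ) ∧
          ((j : ℝ) + u) / (N : ℝ) < C i.succ)).card) :
    ∀ i : Fin N, ∫ u in Set.Ico (0 : ℝ) 1, (n i u : ℝ) = (N : ℝ) * w i := by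
  intro i
  have hNpos : (0 : ℝ) < N := by exact_mod_cast hN
  have hC_nonneg : 0 ≤ C i.castSucc := by
    rw [hC]
    exact Finset.sum_nonneg fun j _ => hw j
  have hC_le_one : C i.succ ≤ 1 := by
    rw [hC, ← hsum]
    exact Finset.sum_le_sum_of_subset_of_nonneg (Finset.filter_subset _ _) fun j _ _ => hw j
  have hC_succ : C i.succ = w i + C i.castSucc := by
    rw [hC, hC, ← Finset.sum_insert (by simp)]
    congr 1
    ext j
    simp only [Finset.mem_filter, Finset.mem_univ, true_and, Finset.mem_insert, Fin.ext_iff,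
      Fin.val_succ, Fin.val_castSucc]
    omega
  have hcount := setIntegral_card_translates_mem_Ico (N := N)
    (a := C i.castSucc * N) (b := C i.succ * N) (by positivity)
    (by gcongr; linarith [hw i]) (by nlinarith)
  simp only [hn, le_div_iff₀ hNpos, div_lt_iff₀ hNpos]
  rw [hcount, hC_succ]
  ring
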